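/- Let S = ℤ[a2001, a1200, a1110, a1101, a0210, M0, M1, N0, N1, p2, p3], w = a2001·a0210 + a1110·a1101, and let (q0, q1, q2, q3) = G(M0 + 2·N0, M1 + 2·N1, p2, p3) ∈ S⁴. Then q2 ≡ 4·w·a1200²·M0¹²·M1⁶·(a1110·M0 + a0210·M1)·(a2001⁸·M0⁸ + a1101⁸·M1⁸) modulo the ideal of S generated by 8, 2·p2, 2·p3, p2², p2·p3 and p3². -/

import Mathlib

/- STATEMENT 7: identity (eq_q2_in_I) from the proof of Lemma 3.9 of the paper.
S = ℤ[a2001, a1200, a1110, a1101, a0210, M0, M1, N0, N1, p2, p3] is realized as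
MvPolynomial (Fin 11) ℤ with the variables in that order (indices 0,…,10).
The cubic f, the Blanc involution tuples σ1, σ2, σ3 and the composite substitution
map G = σ1 ∘ σ2 ∘ σ3 are defined below over an arbitrary commutative ring of
coefficients a : Fin 5 → A. -/

open MvPolynomial

noncomputable section

variable {A : Type} [CommRing A]

/-- The cubic form f = a2001·x0²x3 + a1200·x0x1² + a1110·x0x1x2 + a1101·x0x1x3 + a0210·x1²x2,
with coefficients a = (a2001, a1200, a1110, a1101, a0210) : Fin 5 → A. -/
def cub (a : Fin 5 → A) : MvPolynomial (Fin 4) A :=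
  C (a 0) * X 0 ^ 2 * X 3 + C (a 1) * X 0 * X 1 ^ 2 + C (a 2) * X 0 * X 1 * X 2 +
    C (a 3) * X 0 * X 1 * X 3 + C (a 4) * X 1 ^ 2 * X 2

/-- The Blanc involution tuple σ1 = (x0·∂f/∂x1, x1·∂f/∂x1 − 2f, x2·∂f/∂x1, x3·∂f/∂x1). -/
def sig1 (a : Fin 5 → A) : Fin 4 → MvPolynomial (Fin 4) A :=
  ![X 0 * pderiv 1 (cub a), X 1 * pderiv 1 (cub a) - 2 * cub a,
    X 2 * pderiv 1 (cub a), X 3 * pderiv 1 (cub a)]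

/-- The Blanc involution tuple σ2. -/
def sig2 (a : Fin 5 → A) : Fin 4 → MvPolynomial (Fin 4) A :=
  ![X 0 * pderiv 2 (cub a), X 1 * pderiv 2 (cub a),
    X 2 * pderiv 2 (cub a) - 2 * cub a, X 3 * pderiv 2 (cub a)]

/-- The Blanc involution tuple σ3. -/
def sig3 (a : Fin 5 → A) : Fin 4 → MvPolynomial (Fin 4) A :=
  ![X 0 * pderiv 3 (cub a), X 1 * pderiv 3 (cub a),
    X 2 * pderiv 3 (cub a), X 3 * pderiv 3 (cub a) - 2 * cub a]

/-- G(v) = σ1(σ2(σ3(v))): substitute v into σ3, the result into σ2, that into σ1. -/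
def Gmap (a : Fin 5 → A) (v : Fin 4 → A) : Fin 4 → A :=
  fun i => eval (fun j => eval (fun k => eval v (sig3 a k)) (sig2 a j)) (sig1 a i)

abbrev S₇ : Type := MvPolynomial (Fin 11) ℤ

/-- A ring where `8 = 0`: multiplying by `4` only sees classes modulo `2`. -/
lemma four_mul_of_quot {R : Type} [CommRing R] (h8 : (8 : R) = 0) {u v : R}
    (h : Ideal.Quotient.mk (Ideal.span {(2 : R)}) u = Ideal.Quotient.mk (Ideal.span {(2 : R)}) v) :
    4 * u = 4 * v := by
  rw [Ideal.Quotient.eq, Ideal.mem_span_singleton] at h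
  obtain ⟨t, ht⟩ := h
  linear_combination 4 * ht + t * h8

/-- The eighth power is additive when `2 = 0`. -/
lemma pow_eight_add {R : Type} [CommRing R] (h2 : (2 : R) = 0) (u v : R) :
    (u + v) ^ 8 = u ^ 8 + v ^ 8 := by
  have key : ∀ s t : R, (s + t) ^ 2 = s ^ 2 + t ^ 2 := fun s t => by
    linear_combination s * t * h2
  calc (u + v) ^ 8 = (((u + v) ^ 2) ^ 2) ^ 2 := by ring
    _ = u ^ 8 + v ^ 8 := by rw [key, key, key]; ring

/-- Third step: the final congruence modulo `2`. -/
lemma final_step {R : Type} [CommRing R] (h8 : (8 : R) = 0) (a b c d e M0 M1 N0 N1 : R) :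
    4 * ((a * e - c * d) * b ^ 2 * (M0 + 2 * N0) ^ 12 * (M1 + 2 * N1) ^ 6 *
      (c * (M0 + 2 * N0) + e * (M1 + 2 * N1)) *
      (a * (M0 + 2 * N0) + d * (M1 + 2 * N1)) ^ 8) =
    4 * ((a * e + c * d) * b ^ 2 * M0 ^ 12 * M1 ^ 6 * (c * M0 + e * M1) *
      (a ^ 8 * M0 ^ 8 + d ^ 8 * M1 ^ 8)) := by
  apply four_mul_of_quot h8
  have h2 : Ideal.Quotient.mk (Ideal.span {(2 : R)}) 2 = 0 :=
    Ideal.Quotient.eq_zero_iff_mem.2 (Ideal.subset_span rfl)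
  have h2' : (2 : R ⧸ Ideal.span {(2 : R)}) = 0 :=
    (map_ofNat (Ideal.Quotient.mk (Ideal.span {(2 : R)})) 2).symm.trans h2
  simp only [map_mul, map_add, map_sub, map_pow, h2, zero_mul, add_zero]
  rw [pow_eight_add h2']
  generalize Ideal.Quotient.mk (Ideal.span {(2 : R)}) a = a'
  generalize Ideal.Quotient.mk (Ideal.span {(2 : R)}) b = b'
  generalize Ideal.Quotient.mk (Ideal.span {(2 : R)}) c = c'
  generalize Ideal.Quotient.mk (Ideal.span {(2 : R)}) d = d'
  generalize Ideal.Quotient.mk (Ideal.span {(2 : R)}) e = e'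
  have hw : a' * e' - c' * d' = a' * e' + c' * d' := by
    linear_combination - c' * d' * h2'
  rw [hw]
  ring

/-- Evaluation of the cubic at a point. -/
def cubv {R : Type} [CommRing R] (a b c d e x0 x1 x2 x3 : R) : R :=
  a * x0 ^ 2 * x3 + b * x0 * x1 ^ 2 + c * x0 * x1 * x2 + d * x0 * x1 * x3 + e * x1 ^ 2 * x2

/-- The computation of `q2` in a ring where the generators of the ideal vanish. -/
lemma q2_calc {R : Type} [CommRing R] (a b c d e x0 x1 p r : R) (h8 : (8 : R) = 0)
    (hp : 2 * p = 0) (hr : 2 * r = 0) (hpp : p ^ 2 = 0) (hpr : p * r = 0)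
    (D E y0 y1 y2 y3 z0 z1 z2 z3 : R)
    (hD : D = a * x0 ^ 2 + d * x0 * x1)
    (hy0 : y0 = x0 * D) (hy1 : y1 = x1 * D) (hy2 : y2 = p * D)
    (hy3 : y3 = r * D - 2 * cubv a b c d e x0 x1 p r)
    (hE : E = c * y0 * y1 + e * y1 ^ 2)
    (hz0 : z0 = y0 * E) (hz1 : z1 = y1 * E)
    (hz2 : z2 = y2 * E - 2 * cubv a b c d e y0 y1 y2 y3) (hz3 : z3 = y3 * E) :
    z2 * (2 * b * z0 * z1 + c * z0 * z2 + d * z0 * z3 + 2 * e * z1 * z2) =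
    4 * ((a * e - c * d) * b ^ 2 * x0 ^ 12 * x1 ^ 6 * (c * x0 + e * x1) *
      (a * x0 + d * x1) ^ 8) := by
  have hE' : E = D ^ 2 * x1 * (c * x0 + e * x1) := by rw [hE, hy0, hy1]; ring
  have hy3' : y3 = r * D - 2 * (b * x0 * x1 ^ 2) := by
    rw [hy3, cubv]
    linear_combination (-(c * x0 * x1) - e * x1 ^ 2) * hp - (a * x0 ^ 2 + d * x0 * x1) * hr
  have hDy : a * y0 ^ 2 + d * y0 * y1 = D ^ 3 := by
    rw [hy0, hy1]; linear_combination - D ^ 2 * hD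
  have hy2d : 2 * y2 = 0 := by rw [hy2]; linear_combination D * hp
  have hy3d : 2 * y3 = - 4 * (b * x0 * x1 ^ 2) := by rw [hy3']; linear_combination D * hr
  obtain ⟨K, hK⟩ : ∃ K, K = b * x0 * x1 ^ 2 * D ^ 3 := ⟨_, rfl⟩
  have hz2' : z2 = p * D * E + 2 * K := by
    have hb : b * y0 * y1 ^ 2 = K := by rw [hK, hy0, hy1]; ring
    rw [hz2, cubv]
    linear_combination E * hy2 - 2 * hb - (c * y0 * y1 + e * y1 ^ 2) * hy2d
      - 2 * y3 * hDy - D ^ 3 * hy3d - 4 * hK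
  have e1 : 2 * z2 = 4 * K := by rw [hz2']; linear_combination D * E * hp
  have e2 : z2 ^ 2 = 4 * K ^ 2 := by
    rw [hz2']; linear_combination D ^ 2 * E ^ 2 * hpp + 2 * D * E * K * hp
  have e3 : z2 * z3 = - 4 * (b * x0 * x1 ^ 2) * E * K := by
    rw [hz2', hz3, hy3']
    linear_combination D ^ 2 * E ^ 2 * hpr - (b * x0 * x1 ^ 2) * D * E ^ 2 * hp + K * E * D * hr
  have e4 : z2 * (2 * b * z0 * z1 + c * z0 * z2 + d * z0 * z3 + 2 * e * z1 * z2) =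
      4 * K * z0 * (b * z1 + c * K - d * (b * x0 * x1 ^ 2) * E) := by
    linear_combination b * z0 * z1 * e1 + (c * z0 + 2 * e * z1) * e2 + d * z0 * e3
      + e * z1 * K ^ 2 * h8
  rw [e4]
  have e5 : b * z1 + c * K - d * (b * x0 * x1 ^ 2) * E =
      b * D ^ 2 * x1 ^ 3 * x0 ^ 2 * (a * e - c * d) + 2 * (b * D ^ 2 * x1 ^ 2 * c * x0 * D) := by
    rw [hz1, hy1, hK, hE', hD]; ring
  have e6 : z0 = x0 * x1 * D ^ 3 * (c * x0 + e * x1) := by rw [hz0, hy0, hE']; ring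
  have hD' : D = x0 * (a * x0 + d * x1) := by rw [hD]; ring
  rw [e5, e6, hK, hD']
  generalize a * x0 + d * x1 = L
  generalize a * e - c * d = W
  generalize hQ : c * x0 + e * x1 = Q
  linear_combination (b * x0 * x1 ^ 2 * (x0 * L) ^ 3) * (x0 * x1 * (x0 * L) ^ 3 * Q) *
    (b * (x0 * L) ^ 2 * x1 ^ 2 * c * x0 * (x0 * L)) * h8

lemma eval_cub {A : Type} [CommRing A] (a : Fin 5 → A) (v : Fin 4 → A) :
    eval v (cub a) = cubv (a 0) (a 1) (a 2) (a 3) (a 4) (v 0) (v 1) (v 2) (v 3) := by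
  simp [cub, cubv]

lemma eval_d1 {A : Type} [CommRing A] (a : Fin 5 → A) (v : Fin 4 → A) :
    eval v (pderiv 1 (cub a)) =
      2 * a 1 * v 0 * v 1 + a 2 * v 0 * v 2 + a 3 * v 0 * v 3 + 2 * a 4 * v 1 * v 2 := by
  simp [cub, pderiv_X]; ring

lemma eval_d2 {A : Type} [CommRing A] (a : Fin 5 → A) (v : Fin 4 → A) :
    eval v (pderiv 2 (cub a)) = a 2 * v 0 * v 1 + a 4 * v 1 ^ 2 := by
  simp [cub, pderiv_X]

lemma eval_d3 {A : Type} [CommRing A] (a : Fin 5 → A) (v : Fin 4 → A) :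
    eval v (pderiv 3 (cub a)) = a 0 * v 0 ^ 2 + a 3 * v 0 * v 1 := by
  simp [cub, pderiv_X]

/-- The third component of `G` under a ring map killing the generators. -/
lemma map_Gmap {A R : Type} [CommRing A] [CommRing R] (φ : A →+* R) (a : Fin 5 → A)
    (v : Fin 4 → A) (h8 : (8 : R) = 0) (hp : 2 * φ (v 2) = 0) (hr : 2 * φ (v 3) = 0)
    (hpp : φ (v 2) ^ 2 = 0) (hpr : φ (v 2) * φ (v 3) = 0) :
    φ (Gmap a v 2) = 4 * ((φ (a 0) * φ (a 4) - φ (a 2) * φ (a 3)) * φ (a 1) ^ 2 *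
      φ (v 0) ^ 12 * φ (v 1) ^ 6 * (φ (a 2) * φ (v 0) + φ (a 4) * φ (v 1)) *
      (φ (a 0) * φ (v 0) + φ (a 3) * φ (v 1)) ^ 8) := by
  rw [← q2_calc (φ (a 0)) (φ (a 1)) (φ (a 2)) (φ (a 3)) (φ (a 4)) (φ (v 0)) (φ (v 1))
    (φ (v 2)) (φ (v 3)) h8 hp hr hpp hpr _ _ _ _ _ _ _ _ _ _ rfl rfl rfl rfl rfl rfl rfl rfl
    rfl rfl]
  simp only [Gmap, sig1, sig2, sig3, Matrix.cons_val, map_mul, map_sub, eval_cub, eval_d1,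
    eval_d2, eval_d3, eval_X, map_ofNat, map_add, map_pow, cubv]

/-- The statement after applying a ring map killing the generators. -/
lemma map_main {A R : Type} [CommRing A] [CommRing R] (φ : A →+* R)
    (a b c d e M0 M1 N0 N1 p r : A) (h8 : φ 8 = 0) (hp : φ (2 * p) = 0) (hr : φ (2 * r) = 0)
    (hpp : φ (p ^ 2) = 0) (hpr : φ (p * r) = 0) :
    φ (Gmap ![a, b, c, d, e] ![M0 + 2 * N0, M1 + 2 * N1, p, r] 2 -
      4 * (a * e + c * d) * b ^ 2 * M0 ^ 12 * M1 ^ 6 * (c * M0 + e * M1) *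
        (a ^ 8 * M0 ^ 8 + d ^ 8 * M1 ^ 8)) = 0 := by
  simp only [map_mul, map_pow, map_ofNat] at h8 hp hr hpp hpr
  rw [map_sub, map_Gmap φ _ _ h8 hp hr hpp hpr]
  simp only [Matrix.cons_val, map_add, map_mul, map_pow, map_ofNat]
  rw [final_step h8]
  ring

theorem stmt_7
    (w : S₇) (hw : w = X 0 * X 4 + X 2 * X 3)
    (q : Fin 4 → S₇)
    (hq : q = Gmap ![X 0, X 1, X 2, X 3, X 4]
                   ![X 5 + 2 * X 7, X 6 + 2 * X 8, X 9, X 10]) :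
    q 2 -
      4 * w * X 1 ^ 2 * X 5 ^ 12 * X 6 ^ 6 * (X 2 * X 5 + X 4 * X 6) *
        (X 0 ^ 8 * X 5 ^ 8 + X 3 ^ 8 * X 6 ^ 8)
      ∈ Ideal.span ({(8 : S₇), 2 * X 9, 2 * X 10, X 9 ^ 2, X 9 * X 10, X 10 ^ 2} : Set S₇) := by
  subst hw hq
  have hz : ∀ s ∈ ({(8 : S₇), 2 * X 9, 2 * X 10, X 9 ^ 2, X 9 * X 10, X 10 ^ 2} : Set S₇),
      Ideal.Quotient.mk (Ideal.span ({(8 : S₇), 2 * X 9, 2 * X 10, X 9 ^ 2, X 9 * X 10,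
        X 10 ^ 2} : Set S₇)) s = 0 := fun s hs =>
    Ideal.Quotient.eq_zero_iff_mem.2 (Ideal.subset_span hs)
  refine Ideal.Quotient.eq_zero_iff_mem.1 ?_
  exact map_main _ _ _ _ _ _ _ _ _ _ _ _ (hz _ (.inl rfl)) (hz _ (.inr (.inl rfl)))
    (hz _ (.inr (.inr (.inl rfl)))) (hz _ (.inr (.inr (.inr (.inl rfl)))))
    (hz _ (.inr (.inr (.inr (.inr (.inl rfl))))))
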